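/- Let p, q ≥ 1 and n ≥ 2, and let H = K_{p,q} ∘_1 K_n with Laplacian matrix L, identified vertex u* ∈ P, parts P (|P| = p, u* ∈ P) and Q (|Q| = q), and set C of n−1 new clique vertices. Then for every matrix X with L·X·L = L, the quantity r(i,j) = X_{ii} + X_{jj} − X_{ij} − X_{ji} satisfies: r(u*, j) = 2/q for j ∈ P∖{u*}; r(u*, j) = (p+q−1)/(pq) for j ∈ Q; r(u*, j) = 2/n for j ∈ C; r(i,j) = 2/q for distinct i, j ∈ P∖{u*}; r(i,j) = (p+q−1)/(pq) for i ∈ P∖{u*}, j ∈ Q; r(i,j) = 2(q+n)/(qn) for i ∈ P∖{u*}, j ∈ C; r(i,j) = 2/p for distinct i, j ∈ Q; r(i,j) = (q(n+2p)+n(p−1))/(npq) for i ∈ Q, j ∈ C; r(i,j) = 2/n for distinct i, j ∈ C. -/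

import Mathlib

open Matrix

-- The Laplacian matrix `L = D − A` of a finite simple graph, over `ℝ`.
open Classical in
noncomputable def lapMat {V : Type} [Fintype V] (G : SimpleGraph V) : Matrix V V ℝ :=
  Matrix.of fun i j =>
    if i = j then (Nat.card {v // G.Adj i v} : ℝ)
    else if G.Adj i j then -1 else 0

/-- Vertex set of `K_{p,q} ∘₁ K_n`: the identified vertex `u*`, the remaining
`p − 1` vertices of the part `P`, the part `Q` of size `q`, and the `n − 1` new
clique vertices `C`. -/
abbrev BCV (p' q c : ℕ) := Unit ⊕ (Fin p' ⊕ (Fin q ⊕ Fin c))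

/-- The graph `K_{p,q} ∘₁ K_n` (with `p' = p − 1`, `c = n − 1`): every vertex of
`P = {u*} ∪ P'` is adjacent to every vertex of `Q`, the set `C ∪ {u*}` induces a
clique `K_n`, and there are no other edges. -/
def BipCliqueCoal (p' q c : ℕ) : SimpleGraph (BCV p' q c) :=
  SimpleGraph.fromRel (fun u v =>
    match u, v with
    | Sum.inl _, Sum.inr (Sum.inr _) => True                       -- u* – (Q ∪ C)
    | Sum.inr (Sum.inr _), Sum.inl _ => True
    | Sum.inr (Sum.inl _), Sum.inr (Sum.inr (Sum.inl _)) => True  -- P' – Q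
    | Sum.inr (Sum.inr (Sum.inl _)), Sum.inr (Sum.inl _) => True
    | Sum.inr (Sum.inr (Sum.inr _)), Sum.inr (Sum.inr (Sum.inr _)) => True -- C – C
    | _, _ => False)

theorem lapMat_isSymm {V : Type} [Fintype V] (G : SimpleGraph V) : (lapMat G).IsSymm := by
  refine Matrix.IsSymm.ext fun i j => ?_
  by_cases h : i = j
  · rw [h]
  · by_cases hA : G.Adj i j <;> simp [lapMat, h, Ne.symm h, hA, G.adj_comm j i]

open Classical in
theorem lapMat_mulVec_apply {V : Type} [Fintype V] (G : SimpleGraph V) (v : V → ℝ) (i : V) :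
    (lapMat G *ᵥ v) i = ∑ j, if G.Adj i j then v i - v j else 0 := by
  have hcard : (Nat.card {w // G.Adj i w} : ℝ) * v i = ∑ j, if G.Adj i j then v i else 0 := by
    rw [Nat.card_eq_fintype_card, Fintype.card_subtype, ← Finset.sum_filter, Finset.sum_const,
      nsmul_eq_mul]
  have hentry (j : V) : lapMat G i j * v j =
      (if i = j then (Nat.card {w // G.Adj i w} : ℝ) * v i else 0)
        - if G.Adj i j then v j else 0 := by
    by_cases h : i = j
    · subst h
      simp [lapMat]
    · by_cases hA : G.Adj i j <;> simp [lapMat, h, hA]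
  simp only [mulVec, dotProduct, hentry, Finset.sum_sub_distrib, Finset.sum_ite_eq,
    Finset.mem_univ, if_true, hcard]
  rw [← Finset.sum_sub_distrib]
  refine Finset.sum_congr rfl fun j _ => ?_
  split_ifs <;> simp

theorem dotProduct_mulVec_of_isSymm {V : Type*} [Fintype V] {L X : Matrix V V ℝ}
    (hL : L.IsSymm) (hX : L * X * L = L) {v d : V → ℝ} (h : L *ᵥ v = d) :
    d ⬝ᵥ X *ᵥ d = v ⬝ᵥ d := by
  have hv : v ᵥ* L = d := by rw [← h, ← vecMul_transpose, hL.eq]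
  calc d ⬝ᵥ X *ᵥ d = v ᵥ* L ⬝ᵥ X *ᵥ (L *ᵥ v) := by rw [hv, h]
    _ = v ⬝ᵥ (L * X * L) *ᵥ v := by
      rw [← dotProduct_mulVec, mulVec_mulVec, mulVec_mulVec, Matrix.mul_assoc]
    _ = v ⬝ᵥ d := by rw [hX, h]

/-- A matrix `W` whose columns are potentials grounded at `u` computes the resistances of every
`{1}`-inverse. -/
theorem resistance_eq_of_grounded {V : Type*} [Fintype V] [DecidableEq V] {L X W : Matrix V V ℝ}
    (hL : L.IsSymm) (hX : L * X * L = L) (u : V)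
    (hW : ∀ j, L *ᵥ W.col j = Pi.single j 1 - Pi.single u 1) (i j : V) :
    X i i + X j j - X i j - X j i = W i i + W j j - W i j - W j i := by
  have h : L *ᵥ (W.col i - W.col j) = Pi.single i 1 - Pi.single j 1 := by
    rw [mulVec_sub, hW, hW]
    abel
  have key := dotProduct_mulVec_of_isSymm hL hX h
  simp only [mulVec_sub, mulVec_single_one, sub_dotProduct, dotProduct_sub, single_dotProduct,
    dotProduct_single, Pi.sub_apply, col_apply, one_mul, mul_one] at key
  linarith

/-- The potentials of `K_{p,q} ∘₁ K_n` grounded at `u*`. -/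
noncomputable def groundedPotential (p q n : ℕ) :
    Matrix (BCV (p - 1) q (n - 1)) (BCV (p - 1) q (n - 1)) ℝ :=
  Matrix.of fun x y =>
    match x, y with
    | Sum.inr (Sum.inl i), Sum.inr (Sum.inl j) => (1 + if i = j then 1 else 0) / q
    | Sum.inr (Sum.inl _), Sum.inr (Sum.inr (Sum.inl _)) => 1 / q
    | Sum.inr (Sum.inr (Sum.inl _)), Sum.inr (Sum.inl _) => 1 / q
    | Sum.inr (Sum.inr (Sum.inl i)), Sum.inr (Sum.inr (Sum.inl j)) =>
        (((p : ℝ) - 1) / q + if i = j then 1 else 0) / p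
    | Sum.inr (Sum.inr (Sum.inr i)), Sum.inr (Sum.inr (Sum.inr j)) =>
        (1 + if i = j then 1 else 0) / n
    | _, _ => 0

theorem lapMat_mulVec_groundedPotential {p q n : ℕ} (hp : 1 ≤ p) (hq : 1 ≤ q) (hn : 2 ≤ n)
    (y : BCV (p - 1) q (n - 1)) :
    lapMat (BipCliqueCoal (p - 1) q (n - 1)) *ᵥ (groundedPotential p q n).col y
      = Pi.single y 1 - Pi.single (Sum.inl ()) 1 := by
  have hp0 : (p : ℝ) ≠ 0 := by positivity
  have hq0 : (q : ℝ) ≠ 0 := by positivity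
  have hn0 : (n : ℝ) ≠ 0 := by positivity
  have hp1 : ((p - 1 : ℕ) : ℝ) = p - 1 := by simp [hp]
  have hn1 : ((n - 1 : ℕ) : ℝ) = n - 1 := by simp [show 1 ≤ n by omega]
  have hclique (i j : Fin (n - 1)) :
      (∑ x, if i = x then (0 : ℝ) else (1 + if i = j then 1 else 0) / n
        - (1 + if x = j then 1 else 0) / n) = ((n - 1) * if i = j then 1 else 0) / n - 1 / n := by
    have hdiff (x : Fin (n - 1)) : (if i = x then (0 : ℝ) else (1 + if i = j then 1 else 0) / n
        - (1 + if x = j then 1 else 0) / n)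
        = ((if i = j then 1 else 0) - if x = j then 1 else 0) / n := by
      by_cases h : i = x
      · simp [h]
      · rw [if_neg h]
        ring
    simp [hdiff, ← Finset.sum_div, Finset.sum_sub_distrib, hn1, sub_div]
    split_ifs <;> ring
  ext x
  rw [lapMat_mulVec_apply]
  rcases x with _ | i | i | i <;> rcases y with _ | j | j | j <;>
    simp [hclique, Fintype.sum_sum_type, BipCliqueCoal, groundedPotential, Pi.single_apply, hp1, hn1,
      Finset.sum_sub_distrib, Finset.sum_add_distrib, ← Finset.sum_div]
  all_goals try omega
  all_goals
    try split_ifs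
    all_goals
      field_simp
      try ring

/-- Resistance distances in `K_{p,q} ∘₁ K_n` (`p, q ≥ 1`, `n ≥ 2`). -/
theorem resistance_bipCliqueCoal (p q n : ℕ) (hp : 1 ≤ p) (hq : 1 ≤ q) (hn : 2 ≤ n)
    (X : Matrix (BCV (p - 1) q (n - 1)) (BCV (p - 1) q (n - 1)) ℝ)
    (hX : lapMat (BipCliqueCoal (p - 1) q (n - 1)) * X
          * lapMat (BipCliqueCoal (p - 1) q (n - 1))
        = lapMat (BipCliqueCoal (p - 1) q (n - 1))) :
    -- u* and a vertex of P∖{u*}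
    (∀ j : Fin (p - 1),
      X (Sum.inl ()) (Sum.inl ()) + X (Sum.inr (Sum.inl j)) (Sum.inr (Sum.inl j))
        - X (Sum.inl ()) (Sum.inr (Sum.inl j)) - X (Sum.inr (Sum.inl j)) (Sum.inl ())
        = 2 / (q : ℝ)) ∧
    -- u* and a vertex of Q
    (∀ j : Fin q,
      X (Sum.inl ()) (Sum.inl ())
        + X (Sum.inr (Sum.inr (Sum.inl j))) (Sum.inr (Sum.inr (Sum.inl j)))
        - X (Sum.inl ()) (Sum.inr (Sum.inr (Sum.inl j)))
        - X (Sum.inr (Sum.inr (Sum.inl j))) (Sum.inl ())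
        = ((p : ℝ) + (q : ℝ) - 1) / ((p : ℝ) * (q : ℝ))) ∧
    -- u* and a vertex of C
    (∀ j : Fin (n - 1),
      X (Sum.inl ()) (Sum.inl ())
        + X (Sum.inr (Sum.inr (Sum.inr j))) (Sum.inr (Sum.inr (Sum.inr j)))
        - X (Sum.inl ()) (Sum.inr (Sum.inr (Sum.inr j)))
        - X (Sum.inr (Sum.inr (Sum.inr j))) (Sum.inl ()) = 2 / (n : ℝ)) ∧
    -- two distinct vertices of P∖{u*}
    (∀ i j : Fin (p - 1), i ≠ j →
      X (Sum.inr (Sum.inl i)) (Sum.inr (Sum.inl i))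
        + X (Sum.inr (Sum.inl j)) (Sum.inr (Sum.inl j))
        - X (Sum.inr (Sum.inl i)) (Sum.inr (Sum.inl j))
        - X (Sum.inr (Sum.inl j)) (Sum.inr (Sum.inl i)) = 2 / (q : ℝ)) ∧
    -- a vertex of P∖{u*} and a vertex of Q
    (∀ (i : Fin (p - 1)) (j : Fin q),
      X (Sum.inr (Sum.inl i)) (Sum.inr (Sum.inl i))
        + X (Sum.inr (Sum.inr (Sum.inl j))) (Sum.inr (Sum.inr (Sum.inl j)))
        - X (Sum.inr (Sum.inl i)) (Sum.inr (Sum.inr (Sum.inl j)))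
        - X (Sum.inr (Sum.inr (Sum.inl j))) (Sum.inr (Sum.inl i))
        = ((p : ℝ) + (q : ℝ) - 1) / ((p : ℝ) * (q : ℝ))) ∧
    -- a vertex of P∖{u*} and a vertex of C
    (∀ (i : Fin (p - 1)) (j : Fin (n - 1)),
      X (Sum.inr (Sum.inl i)) (Sum.inr (Sum.inl i))
        + X (Sum.inr (Sum.inr (Sum.inr j))) (Sum.inr (Sum.inr (Sum.inr j)))
        - X (Sum.inr (Sum.inl i)) (Sum.inr (Sum.inr (Sum.inr j)))
        - X (Sum.inr (Sum.inr (Sum.inr j))) (Sum.inr (Sum.inl i))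
        = 2 * ((q : ℝ) + (n : ℝ)) / ((q : ℝ) * (n : ℝ))) ∧
    -- two distinct vertices of Q
    (∀ i j : Fin q, i ≠ j →
      X (Sum.inr (Sum.inr (Sum.inl i))) (Sum.inr (Sum.inr (Sum.inl i)))
        + X (Sum.inr (Sum.inr (Sum.inl j))) (Sum.inr (Sum.inr (Sum.inl j)))
        - X (Sum.inr (Sum.inr (Sum.inl i))) (Sum.inr (Sum.inr (Sum.inl j)))
        - X (Sum.inr (Sum.inr (Sum.inl j))) (Sum.inr (Sum.inr (Sum.inl i)))
        = 2 / (p : ℝ)) ∧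
    -- a vertex of Q and a vertex of C
    (∀ (i : Fin q) (j : Fin (n - 1)),
      X (Sum.inr (Sum.inr (Sum.inl i))) (Sum.inr (Sum.inr (Sum.inl i)))
        + X (Sum.inr (Sum.inr (Sum.inr j))) (Sum.inr (Sum.inr (Sum.inr j)))
        - X (Sum.inr (Sum.inr (Sum.inl i))) (Sum.inr (Sum.inr (Sum.inr j)))
        - X (Sum.inr (Sum.inr (Sum.inr j))) (Sum.inr (Sum.inr (Sum.inl i)))
        = ((q : ℝ) * ((n : ℝ) + 2 * (p : ℝ)) + (n : ℝ) * ((p : ℝ) - 1))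
            / ((n : ℝ) * (p : ℝ) * (q : ℝ))) ∧
    -- two distinct vertices of C
    (∀ i j : Fin (n - 1), i ≠ j →
      X (Sum.inr (Sum.inr (Sum.inr i))) (Sum.inr (Sum.inr (Sum.inr i)))
        + X (Sum.inr (Sum.inr (Sum.inr j))) (Sum.inr (Sum.inr (Sum.inr j)))
        - X (Sum.inr (Sum.inr (Sum.inr i))) (Sum.inr (Sum.inr (Sum.inr j)))
        - X (Sum.inr (Sum.inr (Sum.inr j))) (Sum.inr (Sum.inr (Sum.inr i)))
        = 2 / (n : ℝ)) := by
  have hp0 : (p : ℝ) ≠ 0 := by positivity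
  have hq0 : (q : ℝ) ≠ 0 := by positivity
  have hn0 : (n : ℝ) ≠ 0 := by positivity
  have hr := resistance_eq_of_grounded (lapMat_isSymm _) hX (Sum.inl ())
    (lapMat_mulVec_groundedPotential hp hq hn)
  refine ⟨fun j => ?_, fun j => ?_, fun j => ?_, fun i j hij => ?_, fun i j => ?_, fun i j => ?_,
    fun i j hij => ?_, fun i j => ?_, fun i j hij => ?_⟩
  all_goals
    rw [hr]
    simp [groundedPotential, *, Ne.symm]
    try field_simp
    try ring
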